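/- If R is an IF ring (every injective left R-module and every injective right R-module is flat), then every left R-module is Gorenstein flat and every right R-module is Gorenstein flat. -/

import Mathlib

/-!
Background definitions for D. Bennis, "Weak Gorenstein global dimensions".

Conventions.  All rings are associative with identity.  A *left* `R`-module is a type with
`[AddCommGroup M] [Module R M]`; a *right* `R`-module is a left module over the opposite ring,
i.e. `[Module Rᵐᵒᵖ M]`.  All "right-handed" notions below are obtained by applying the
corresponding "left-handed" notion to the opposite ring `Rᵐᵒᵖ`.
-/

open MulOpposite

universe u

section Tensor

variable (S : Type u) [Ring S]

/-- The subgroup of relations defining the tensor product `A ⊗_S M` of a right `S`-module `A`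
and a left `S`-module `M` over a (possibly noncommutative) ring `S`. -/
def tensorRels (A : Type u) [AddCommGroup A] [Module Sᵐᵒᵖ A]
    (M : Type u) [AddCommGroup M] [Module S M] :
    AddSubgroup (FreeAbelianGroup (A × M)) :=
  AddSubgroup.closure
    { x | (∃ a₁ a₂ m, x = FreeAbelianGroup.of (a₁ + a₂, m) - FreeAbelianGroup.of (a₁, m) -
            FreeAbelianGroup.of (a₂, m)) ∨
          (∃ a m₁ m₂, x = FreeAbelianGroup.of (a, m₁ + m₂) - FreeAbelianGroup.of (a, m₁) -
            FreeAbelianGroup.of (a, m₂)) ∨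
          (∃ (a : A) (r : S) (m : M), x = FreeAbelianGroup.of (op r • a, m) - FreeAbelianGroup.of (a, r • m)) }

/-- The tensor product `A ⊗_S M` (an abelian group) of a right `S`-module `A` and a left
`S`-module `M` over a (possibly noncommutative) ring `S`. -/
def NTensor (A : Type u) [AddCommGroup A] [Module Sᵐᵒᵖ A]
    (M : Type u) [AddCommGroup M] [Module S M] : Type u :=
  FreeAbelianGroup (A × M) ⧸ tensorRels S A M

instance (A : Type u) [AddCommGroup A] [Module Sᵐᵒᵖ A]
    (M : Type u) [AddCommGroup M] [Module S M] : AddCommGroup (NTensor S A M) :=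
  QuotientAddGroup.Quotient.addCommGroup _

namespace NTensor

variable {S}
variable {A A' : Type u} [AddCommGroup A] [Module Sᵐᵒᵖ A] [AddCommGroup A'] [Module Sᵐᵒᵖ A']
variable {M M' : Type u} [AddCommGroup M] [Module S M] [AddCommGroup M'] [Module S M']

/-- Functoriality of `A ⊗_S −` : the map `A ⊗_S M → A ⊗_S M'` induced by a linear map
`g : M → M'` of left `S`-modules. -/
def rmap (A : Type u) [AddCommGroup A] [Module Sᵐᵒᵖ A] (g : M →ₗ[S] M') :
    NTensor S A M →+ NTensor S A M' :=
  QuotientAddGroup.map (tensorRels S A M) (tensorRels S A M') (FreeAbelianGroup.map (Prod.map id g)) (by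
    simp only [tensorRels]
    refine (AddSubgroup.closure_le _).2 ?_
    rintro x (⟨a₁, a₂, m, rfl⟩ | ⟨a, m₁, m₂, rfl⟩ | ⟨a, r, m, rfl⟩) <;>
      refine SetLike.mem_coe.2 (AddSubgroup.mem_comap.2 (AddSubgroup.subset_closure ?_)) <;>
      simp only [map_sub, map_add, map_smul, FreeAbelianGroup.map_of_apply, Prod.map_apply,
        id_eq, Set.mem_setOf_eq]
    · exact Or.inl ⟨a₁, a₂, g m, rfl⟩
    · exact Or.inr (Or.inl ⟨a, g m₁, g m₂, rfl⟩)
    · exact Or.inr (Or.inr ⟨a, r, g m, rfl⟩))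

/-- Functoriality of `− ⊗_S M` : the map `A ⊗_S M → A' ⊗_S M` induced by a linear map
`f : A → A'` of right `S`-modules. -/
def lmap (M : Type u) [AddCommGroup M] [Module S M] (f : A →ₗ[Sᵐᵒᵖ] A') :
    NTensor S A M →+ NTensor S A' M :=
  QuotientAddGroup.map (tensorRels S A M) (tensorRels S A' M) (FreeAbelianGroup.map (Prod.map f id)) (by
    simp only [tensorRels]
    refine (AddSubgroup.closure_le _).2 ?_
    rintro x (⟨a₁, a₂, m, rfl⟩ | ⟨a, m₁, m₂, rfl⟩ | ⟨a, r, m, rfl⟩) <;>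
      refine SetLike.mem_coe.2 (AddSubgroup.mem_comap.2 (AddSubgroup.subset_closure ?_)) <;>
      simp only [map_sub, map_add, map_smul, FreeAbelianGroup.map_of_apply, Prod.map_apply,
        id_eq, Set.mem_setOf_eq]
    · exact Or.inl ⟨f a₁, f a₂, m, rfl⟩
    · exact Or.inr (Or.inl ⟨f a, m₁, m₂, rfl⟩)
    · exact Or.inr (Or.inr ⟨f a, r, m, rfl⟩))

end NTensor

end Tensor

section Dims

variable (S : Type u) [Ring S]

/-- A left `S`-module `M` is *flat* if tensoring with it preserves injectivity of maps of
right `S`-modules. -/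
def IsFlatMod (M : ModuleCat.{u} S) : Prop :=
  ∀ (A B : Type u) [AddCommGroup A] [Module Sᵐᵒᵖ A] [AddCommGroup B] [Module Sᵐᵒᵖ B]
    (f : A →ₗ[Sᵐᵒᵖ] B), Function.Injective f →
      Function.Injective (NTensor.lmap (↥M) f)

/-- A left `S`-module `M` is *Gorenstein flat* if there is an exact sequence
`⋯ → F (-1) → F 0 → F 1 → ⋯` of flat left `S`-modules with `M ≅ Im (F 0 → F 1)` which stays
exact after applying `I ⊗_S −` for every injective right `S`-module `I`
(a *complete flat resolution*). -/
def IsGorensteinFlat (M : ModuleCat.{u} S) : Prop :=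
  ∃ (F : ℤ → ModuleCat.{u} S) (d : ∀ n : ℤ, ↥(F n) →ₗ[S] ↥(F (n + 1))),
    (∀ n, IsFlatMod S (F n)) ∧
    (∀ n, Function.Exact (d n) (d (n + 1))) ∧
    Nonempty (↥M ≃ₗ[S] ↥(LinearMap.range (d 0))) ∧
    (∀ (I : Type u) [AddCommGroup I] [Module Sᵐᵒᵖ I], Module.Injective Sᵐᵒᵖ I →
      ∀ n, Function.Exact (NTensor.rmap I (d n)) (NTensor.rmap I (d (n + 1))))

/-- `gflatDimLE S n M` means `Gfd_S(M) ≤ n`: there is an exact sequence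
`0 → G_n → ⋯ → G_0 → M → 0` of left `S`-modules with all `G_i` Gorenstein flat. -/
def gflatDimLE : ℕ → ModuleCat.{u} S → Prop
  | 0, M => IsGorensteinFlat S M
  | n + 1, M => ∃ (K G : ModuleCat.{u} S) (ι : ↥K →ₗ[S] ↥G) (π : ↥G →ₗ[S] ↥M),
      Function.Injective ι ∧ Function.Surjective π ∧ Function.Exact ι π ∧
      IsGorensteinFlat S G ∧ gflatDimLE n K

/-- `flatDimLE S n M` means `fd_S(M) ≤ n`: there is an exact sequence
`0 → F_n → ⋯ → F_0 → M → 0` of left `S`-modules with all `F_i` flat. -/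
def flatDimLE : ℕ → ModuleCat.{u} S → Prop
  | 0, M => IsFlatMod S M
  | n + 1, M => ∃ (K F : ModuleCat.{u} S) (ι : ↥K →ₗ[S] ↥F) (π : ↥F →ₗ[S] ↥M),
      Function.Injective ι ∧ Function.Surjective π ∧ Function.Exact ι π ∧
      IsFlatMod S F ∧ flatDimLE n K

/-- `injDimLE S n M` means `id_S(M) ≤ n`: there is an exact sequence
`0 → M → I^0 → ⋯ → I^n → 0` of left `S`-modules with all `I^i` injective. -/
def injDimLE : ℕ → ModuleCat.{u} S → Prop
  | 0, M => Module.Injective S ↥M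
  | n + 1, M => ∃ (I C : ModuleCat.{u} S) (ι : ↥M →ₗ[S] ↥I) (π : ↥I →ₗ[S] ↥C),
      Function.Injective ι ∧ Function.Surjective π ∧ Function.Exact ι π ∧
      Module.Injective S ↥I ∧ injDimLE n C

/-- The Gorenstein flat dimension `Gfd_S(M) ∈ ℕ∞` of a left `S`-module `M`. -/
noncomputable def gflatDim (M : ModuleCat.{u} S) : ℕ∞ :=
  sInf {d : ℕ∞ | ∃ n : ℕ, d = n ∧ gflatDimLE S n M}

/-- The flat dimension `fd_S(M) ∈ ℕ∞` of a left `S`-module `M`. -/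
noncomputable def flatDim (M : ModuleCat.{u} S) : ℕ∞ :=
  sInf {d : ℕ∞ | ∃ n : ℕ, d = n ∧ flatDimLE S n M}

/-- The injective dimension `id_S(M) ∈ ℕ∞` of a left `S`-module `M`. -/
noncomputable def injDim (M : ModuleCat.{u} S) : ℕ∞ :=
  sInf {d : ℕ∞ | ∃ n : ℕ, d = n ∧ injDimLE S n M}

/-- The left weak Gorenstein global dimension
`l.Gwdim(S) = sup { Gfd_S(M) | M a left S-module }`.  The right weak Gorenstein global
dimension of `S` is `gorensteinWeakGlobalDim Sᵐᵒᵖ`. -/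
noncomputable def gorensteinWeakGlobalDim : ℕ∞ :=
  ⨆ M : ModuleCat.{u} S, gflatDim S M

/-- The left weak global dimension `sup { fd_S(M) | M a left S-module }`.  (By a classical
theorem it agrees with `weakGlobalDim Sᵐᵒᵖ`, and the common value is `wdim S`.) -/
noncomputable def weakGlobalDim : ℕ∞ :=
  ⨆ M : ModuleCat.{u} S, flatDim S M

/-- The left finitistic flat dimension
`l.FFD(S) = sup { fd_S(M) | M a left S-module with fd_S(M) < ∞ }`. -/
noncomputable def finitisticFlatDim : ℕ∞ :=
  sSup {d : ℕ∞ | d ≠ ⊤ ∧ ∃ M : ModuleCat.{u} S, flatDim S M = d}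

/-- The left finitistic Gorenstein flat dimension
`l.FGFD(S) = sup { Gfd_S(M) | M a left S-module with Gfd_S(M) < ∞ }`. -/
noncomputable def finitisticGFlatDim : ℕ∞ :=
  sSup {d : ℕ∞ | d ≠ ⊤ ∧ ∃ M : ModuleCat.{u} S, gflatDim S M = d}

/-- A ring `S` is *left GF-closed* if the class of Gorenstein flat left `S`-modules is closed
under extensions.  `S` is right GF-closed iff `Sᵐᵒᵖ` is left GF-closed, and GF-closed if both. -/
def IsGFClosed : Prop :=
  ∀ (A B C : ModuleCat.{u} S) (f : ↥A →ₗ[S] ↥B) (g : ↥B →ₗ[S] ↥C),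
    Function.Injective f → Function.Surjective g → Function.Exact f g →
      IsGorensteinFlat S A → IsGorensteinFlat S C → IsGorensteinFlat S B

/-- A ring `S` is *left coherent* if every finitely generated left ideal of `S` is finitely
presented (as a left `S`-module).  `S` is right coherent iff `Sᵐᵒᵖ` is left coherent. -/
def IsLeftCoherent : Prop :=
  ∀ I : Submodule S S, I.FG → Module.FinitePresentation S ↥I

/-- A ring `S` is *left IF* if every injective left `S`-module is flat.  `S` is right IF iff
`Sᵐᵒᵖ` is left IF, and IF if both. -/
def IsLeftIF : Prop :=
  ∀ E : ModuleCat.{u} S, Module.Injective S ↥E → IsFlatMod S E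

/-- A ring `S` is *left `n`-IF* if `fd_S(E) ≤ n` for every injective left `S`-module `E`.
`S` is right `n`-IF iff `Sᵐᵒᵖ` is left `n`-IF, and `n`-IF if both. -/
def IsLeftNIF (n : ℕ) : Prop :=
  ∀ E : ModuleCat.{u} S, Module.Injective S ↥E → flatDim S E ≤ (n : ℕ∞)

/-- `Ext¹_S(T, K) = 0`, expressed by its standard characterization: every extension of `T`
by `K` (i.e. every short exact sequence `0 → K → X → T → 0`) splits. -/
def Ext1Zero (T K : ModuleCat.{u} S) : Prop :=
  ∀ (X : ModuleCat.{u} S) (ι : ↥K →ₗ[S] ↥X) (π : ↥X →ₗ[S] ↥T),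
    Function.Injective ι → Function.Surjective π → Function.Exact ι π →
      ∃ ρ : ↥X →ₗ[S] ↥K, ρ.comp ι = LinearMap.id

/-- A left `S`-module `K` is *cotorsion* if `Ext¹_S(F, K) = 0` for every flat left
`S`-module `F`. -/
def IsCotorsion (K : ModuleCat.{u} S) : Prop :=
  ∀ F : ModuleCat.{u} S, IsFlatMod S F → Ext1Zero S F K

/-- `Tor₁^S(A, T) = 0` for a right `S`-module `A` and a left `S`-module `T`, expressed by its
standard characterization: for every short exact sequence `0 → K → F → T → 0` of left
`S`-modules with `F` flat, the induced map `A ⊗_S K → A ⊗_S F` is injective. -/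
def Tor1Zero (A : Type u) [AddCommGroup A] [Module Sᵐᵒᵖ A] (T : ModuleCat.{u} S) : Prop :=
  ∀ (K F : ModuleCat.{u} S) (ι : ↥K →ₗ[S] ↥F) (π : ↥F →ₗ[S] ↥T),
    IsFlatMod S F → Function.Injective ι → Function.Surjective π → Function.Exact ι π →
      Function.Injective (NTensor.rmap A ι)

/-- A left `S`-module is *finitely presented* if it admits a presentation with finitely many
generators and relations. -/
abbrev IsFinitelyPresented (M : ModuleCat.{u} S) : Prop :=
  Module.FinitePresentation S ↥M

end Dims
namespace NTensor

section Basic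

variable {S : Type u} [Ring S]
variable {A A' : Type u} [AddCommGroup A] [Module Sᵐᵒᵖ A] [AddCommGroup A'] [Module Sᵐᵒᵖ A']
variable {M M' M'' : Type u} [AddCommGroup M] [Module S M] [AddCommGroup M'] [Module S M']
  [AddCommGroup M''] [Module S M'']
variable {G : Type*} [AddCommGroup G]

/-- The pure tensor `a ⊗ m`. -/
def tmul (S : Type u) [Ring S] {A M : Type u} [AddCommGroup A] [Module Sᵐᵒᵖ A]
    [AddCommGroup M] [Module S M] (a : A) (m : M) : NTensor S A M :=
  QuotientAddGroup.mk (s := tensorRels S A M) (FreeAbelianGroup.of (a, m))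

theorem mk_eq_zero {x : FreeAbelianGroup (A × M)} (hx : x ∈ tensorRels S A M) :
    QuotientAddGroup.mk' (tensorRels S A M) x = 0 :=
  (QuotientAddGroup.eq_zero_iff x).2 hx

theorem add_tmul (a₁ a₂ : A) (m : M) :
    tmul S (a₁ + a₂) m = tmul S a₁ m + tmul S a₂ m := by
  have h := mk_eq_zero (S := S) (AddSubgroup.subset_closure (Or.inl ⟨a₁, a₂, m, rfl⟩))
  rw [map_sub, map_sub, sub_sub, sub_eq_zero] at h
  exact h

theorem tmul_add (a : A) (m₁ m₂ : M) :
    tmul S a (m₁ + m₂) = tmul S a m₁ + tmul S a m₂ := by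
  have h := mk_eq_zero (S := S)
    (AddSubgroup.subset_closure (Or.inr (Or.inl ⟨a, m₁, m₂, rfl⟩)))
  rw [map_sub, map_sub, sub_sub, sub_eq_zero] at h
  exact h

theorem op_smul_tmul (a : A) (r : S) (m : M) : tmul S (op r • a) m = tmul S a (r • m) := by
  have h := mk_eq_zero (S := S)
    (AddSubgroup.subset_closure (Or.inr (Or.inr ⟨a, r, m, rfl⟩)))
  rw [map_sub, sub_eq_zero] at h
  exact h

/-- The additive map `m ↦ a ⊗ m`. -/
def tmulRight (M : Type u) [AddCommGroup M] [Module S M] (a : A) : M →+ NTensor S A M :=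
  AddMonoidHom.mk' (tmul S a) (tmul_add a)

/-- The additive map `a ↦ a ⊗ m`. -/
def tmulLeft (A : Type u) [AddCommGroup A] [Module Sᵐᵒᵖ A] (m : M) : A →+ NTensor S A M :=
  AddMonoidHom.mk' (fun a => tmul S a m) fun a₁ a₂ => add_tmul a₁ a₂ m

/-- The map out of `A ⊗_S M` induced by a balanced biadditive map. -/
def lift (φ : A → M → G) (hl : ∀ a₁ a₂ m, φ (a₁ + a₂) m = φ a₁ m + φ a₂ m)
    (hr : ∀ a m₁ m₂, φ a (m₁ + m₂) = φ a m₁ + φ a m₂)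
    (hb : ∀ a (r : S) m, φ (op r • a) m = φ a (r • m)) : NTensor S A M →+ G :=
  QuotientAddGroup.lift (tensorRels S A M) (FreeAbelianGroup.lift fun p => φ p.1 p.2) (by
    refine (AddSubgroup.closure_le _).2 ?_
    rintro x (⟨a₁, a₂, m, rfl⟩ | ⟨a, m₁, m₂, rfl⟩ | ⟨a, r, m, rfl⟩) <;>
      refine SetLike.mem_coe.2 (AddMonoidHom.mem_ker.2 ?_) <;>
      simp only [map_sub, FreeAbelianGroup.lift_apply_of]
    · rw [hl, sub_sub, sub_self]
    · rw [hr, sub_sub, sub_self]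
    · rw [hb, sub_self])

@[simp]
theorem lift_tmul (φ : A → M → G) (hl hr hb) (a : A) (m : M) :
    lift (S := S) φ hl hr hb (tmul S a m) = φ a m :=
  FreeAbelianGroup.lift_apply_of _ _

@[simp]
theorem rmap_tmul (g : M →ₗ[S] M') (a : A) (m : M) :
    rmap A g (tmul S a m) = tmul S a (g m) := by
  change QuotientAddGroup.mk (FreeAbelianGroup.map _ (FreeAbelianGroup.of _)) = _
  rw [FreeAbelianGroup.map_of_apply]
  rfl

@[simp]
theorem lmap_tmul (f : A →ₗ[Sᵐᵒᵖ] A') (a : A) (m : M) :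
    lmap M f (tmul S a m) = tmul S (f a) m := by
  change QuotientAddGroup.mk (FreeAbelianGroup.map _ (FreeAbelianGroup.of _)) = _
  rw [FreeAbelianGroup.map_of_apply]
  rfl

theorem hom_ext {f g : NTensor S A M →+ G} (h : ∀ a m, f (tmul S a m) = g (tmul S a m)) :
    f = g := by
  apply QuotientAddGroup.addMonoidHom_ext
  apply FreeAbelianGroup.lift_ext
  rintro ⟨a, m⟩
  exact h a m

theorem rmap_comp (g : M' →ₗ[S] M'') (f : M →ₗ[S] M') :
    rmap A (g ∘ₗ f) = (rmap A g).comp (rmap A f) :=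
  hom_ext fun a m => by simp

/-- Right exactness of `A ⊗_S −`. -/
theorem rmap_exact {f : M →ₗ[S] M'} {g : M' →ₗ[S] M''} (hfg : Function.Exact f g)
    (hg : Function.Surjective g) : Function.Exact (rmap A f) (rmap A g) := by
  let q := QuotientAddGroup.mk' (rmap A f).range
  have hq : ∀ (a : A) (x y : M'), g x = g y → q (tmul S a x) = q (tmul S a y) := by
    intro a x y hxy
    obtain ⟨z, hz⟩ := (hfg (x - y)).1 (by rw [map_sub, hxy, sub_self])
    have hx : x = f z + y := by rw [hz, sub_add_cancel]
    have hz : q (tmul S a (f z)) = 0 :=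
      (QuotientAddGroup.eq_zero_iff _).2 ⟨tmul S a z, rmap_tmul f a z⟩
    rw [hx, tmul_add, map_add, hz, zero_add]
  let s := Function.surjInv hg
  have hs : ∀ c, g (s c) = c := Function.surjInv_eq hg
  let k : NTensor S A M'' →+ NTensor S A M' ⧸ (rmap A f).range :=
    lift (fun a c => q (tmul S a (s c)))
      (fun a₁ a₂ c => by rw [add_tmul, map_add])
      (fun a c₁ c₂ => by
        rw [← map_add, ← tmul_add]
        exact hq _ _ _ (by simp only [map_add, hs]))
      (fun a r c => by
        rw [op_smul_tmul]
        exact hq _ _ _ (by simp only [map_smul, hs]))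
  have hk : k.comp (rmap A g) = q := hom_ext fun a m => by
    simp only [AddMonoidHom.comp_apply, rmap_tmul, k, lift_tmul]
    exact hq _ _ _ (hs _)
  intro x
  constructor
  · intro hx
    refine (QuotientAddGroup.eq_zero_iff (N := (rmap A f).range) x).1 ?_
    change q x = 0
    rw [← hk, AddMonoidHom.comp_apply, hx, map_zero]
  · rintro ⟨y, rfl⟩
    rw [← AddMonoidHom.comp_apply, ← rmap_comp, hfg.linearMap_comp_eq_zero]
    refine DFunLike.congr_fun (hom_ext (g := 0) fun a m => ?_) y
    rw [rmap_tmul]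
    exact map_zero (tmulRight M'' a)

/-- The map `A ⊗_S S^(ι) → A^(ι)`. -/
noncomputable def toFinsupp (A : Type u) [AddCommGroup A] [Module Sᵐᵒᵖ A] (ι : Type u) :
    NTensor S A (ι →₀ S) →+ (ι →₀ A) :=
  lift (fun a v => v.mapRange (fun s => op s • a) (by simp))
    (fun a₁ a₂ v => by ext; simp)
    (fun a v₁ v₂ => by ext; simp [add_smul])
    (fun a r v => by ext; simp [mul_smul])

theorem toFinsupp_injective (ι : Type u) : Function.Injective (toFinsupp (S := S) A ι) := by
  let k : (ι →₀ A) →+ NTensor S A (ι →₀ S) :=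
    Finsupp.liftAddHom fun i => tmulLeft A (Finsupp.single i (1 : S))
  have hk : k.comp (toFinsupp A ι) = AddMonoidHom.id _ := hom_ext fun a v => by
    have key : ((k.comp (toFinsupp A ι)).comp (tmulRight (ι →₀ S) a)) =
        tmulRight (ι →₀ S) a := by
      ext i s
      change k (toFinsupp A ι (tmul S a (Finsupp.single i s))) = tmul S a (Finsupp.single i s)
      rw [toFinsupp, lift_tmul, Finsupp.mapRange_single, Finsupp.liftAddHom_apply_single]
      change tmul S (op s • a) (Finsupp.single i (1 : S)) = _
      rw [op_smul_tmul, Finsupp.smul_single, smul_eq_mul, mul_one]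
    exact DFunLike.congr_fun key v
  exact Function.LeftInverse.injective (g := k) (DFunLike.congr_fun hk)

theorem toFinsupp_lmap (ι : Type u) (f : A →ₗ[Sᵐᵒᵖ] A') (x : NTensor S A (ι →₀ S)) :
    toFinsupp A' ι (lmap (ι →₀ S) f x) =
      Finsupp.mapRange.addMonoidHom f.toAddMonoidHom (toFinsupp A ι x) := by
  refine DFunLike.congr_fun (f := (toFinsupp A' ι).comp (lmap (ι →₀ S) f))
    (g := (Finsupp.mapRange.addMonoidHom f.toAddMonoidHom).comp (toFinsupp A ι))
    (hom_ext fun a v => ?_) x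
  ext i
  simp [toFinsupp]

end Basic

/-- If the right `S`-module `I` is, viewed as a left module over `T ≃ Sᵐᵒᵖ`, flat, then
`I ⊗_S −` preserves injectivity. -/
theorem rmap_injective_of_isFlatMod {S T : Type u} [Ring S] [Ring T] (e : T ≃+* Sᵐᵒᵖ)
    {I : Type u} [AddCommGroup I] [Module Sᵐᵒᵖ I] [Module T I]
    (he : ∀ (t : T) (x : I), t • x = e t • x) (hI : IsFlatMod T (ModuleCat.of T I))
    {A B : Type u} [AddCommGroup A] [Module S A] [AddCommGroup B] [Module S B]
    (f : A →ₗ[S] B) (hf : Function.Injective f) : Function.Injective (rmap I f) := by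
  let e' : Tᵐᵒᵖ ≃+* S := (RingEquiv.op e).trans (RingEquiv.opOp S).symm
  let _ : Module Tᵐᵒᵖ A := Module.compHom A e'.toRingHom
  let _ : Module Tᵐᵒᵖ B := Module.compHom B e'.toRingHom
  have hop : ∀ t, op (e' (op t)) = e t := fun t => rfl
  let f' : A →ₗ[Tᵐᵒᵖ] B :=
    { toFun := f, map_add' := f.map_add, map_smul' := fun t a => f.map_smul (e' t) a }
  let toSwap (X : Type u) [AddCommGroup X] [Module S X] [Module Tᵐᵒᵖ X]
      (hX : ∀ (t : Tᵐᵒᵖ) (x : X), t • x = e' t • x) : NTensor S I X →+ NTensor T X I :=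
    lift (fun i x => tmul T x i) (fun _ _ _ => tmul_add _ _ _) (fun _ _ _ => add_tmul _ _ _)
      (fun i r x => by
        have h₁ : op r • i = e.symm (op r) • i := by rw [he, RingEquiv.apply_symm_apply]
        have h₂ : r • x = op (e.symm (op r)) • x := by
          rw [hX]
          congr 1
          apply op_injective
          rw [hop, RingEquiv.apply_symm_apply]
        rw [h₁, h₂, op_smul_tmul])
  let ofSwap : NTensor T A I →+ NTensor S I A :=
    lift (fun x i => tmul S i x) (fun _ _ _ => tmul_add _ _ _) (fun _ _ _ => add_tmul _ _ _)
      (fun x t i => by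
        change tmul S i (e' (op t) • x) = _
        rw [he, ← op_smul_tmul, hop])
  have hinj : Function.Injective (toSwap A fun _ _ => rfl) := by
    have h : ofSwap.comp (toSwap A fun _ _ => rfl) = AddMonoidHom.id _ :=
      hom_ext fun i x => by simp [toSwap, ofSwap]
    exact Function.LeftInverse.injective (g := ofSwap) (DFunLike.congr_fun h)
  have hcomm : (toSwap B fun _ _ => rfl).comp (rmap I f) =
      (lmap I f').comp (toSwap A fun _ _ => rfl) :=
    hom_ext fun i x => by
      simp only [toSwap, AddMonoidHom.comp_apply, rmap_tmul, lift_tmul, lmap_tmul]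
      rfl
  have h : Function.Injective ((lmap I f').comp (toSwap A fun _ _ => rfl)) :=
    (hI A B f' hf).comp hinj
  rw [← hcomm] at h
  exact Function.Injective.of_comp h

end NTensor

section Flat

variable (S : Type u) [Ring S]

theorem isFlatMod_finsupp (ι : Type u) : IsFlatMod S (ModuleCat.of S (ι →₀ S)) := by
  intro A B _ _ _ _ f hf
  have h : Function.Injective (NTensor.toFinsupp B ι ∘ NTensor.lmap (ι →₀ S) f) := by
    intro x y hxy
    simp only [Function.comp_apply, NTensor.toFinsupp_lmap] at hxy
    exact NTensor.toFinsupp_injective ι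
      (Finsupp.mapRange_injective f (map_zero f) hf hxy)
  exact h.of_comp

/-- There is a short exact sequence `0 → K → F → C → 0` with `F` flat. -/
def HasFlatExtension (K C : ModuleCat.{u} S) : Prop :=
  ∃ (F : ModuleCat.{u} S) (ι : ↥K →ₗ[S] ↥F) (π : ↥F →ₗ[S] ↥C),
    IsFlatMod S F ∧ Function.Injective ι ∧ Function.Surjective π ∧ Function.Exact ι π

theorem exists_hasFlatExtension_left (M : ModuleCat.{u} S) : ∃ K, HasFlatExtension S K M := by
  let π : (M →₀ S) →ₗ[S] M := Finsupp.linearCombination S id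
  exact ⟨ModuleCat.of S (LinearMap.ker π), ModuleCat.of S (M →₀ S), (LinearMap.ker π).subtype, π,
    isFlatMod_finsupp S M, Submodule.injective_subtype _,
    Finsupp.linearCombination_id_surjective S M, LinearMap.exact_subtype_ker_map π⟩

variable {S}

theorem IsLeftIF.exists_hasFlatExtension_right (h : IsLeftIF S) (M : ModuleCat.{u} S) :
    ∃ C, HasFlatExtension S M C := by
  obtain ⟨⟨I, hI, f, hf⟩⟩ := CategoryTheory.EnoughInjectives.presentation M
  exact ⟨ModuleCat.of S (I ⧸ LinearMap.range f.hom), I, f.hom, (LinearMap.range f.hom).mkQ,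
    h I ((Module.injective_iff_injective_object S I).2 hI), (ModuleCat.mono_iff_injective f).1 hf,
    Submodule.mkQ_surjective _, LinearMap.exact_map_mkQ_range f.hom⟩

end Flat

/-- A relation that is total in both directions has bi-infinite chains through every point. -/
theorem exists_int_chain {α : Type*} {P : α → α → Prop} (hr : ∀ a, ∃ b, P a b)
    (hl : ∀ b, ∃ a, P a b) (a : α) : ∃ Z : ℤ → α, Z 0 = a ∧ ∀ n, P (Z n) (Z (n + 1)) := by
  choose next hnext using hr
  choose prev hprev using hl
  let Z : ℤ → α
    | Int.ofNat n => next^[n] a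
    | Int.negSucc n => prev^[n + 1] a
  refine ⟨Z, rfl, ?_⟩
  rintro (n | _ | n)
  · change P (next^[n] a) (next^[n + 1] a)
    rw [Function.iterate_succ_apply']
    exact hnext _
  · exact hprev a
  · change P (prev^[n + 1 + 1] a) (prev^[n + 1] a)
    rw [Function.iterate_succ_apply']
    exact hprev _

theorem IsLeftIF.isGorensteinFlat {S : Type u} [Ring S] (h : IsLeftIF S)
    (H : ∀ (I : Type u) [AddCommGroup I] [Module Sᵐᵒᵖ I], Module.Injective Sᵐᵒᵖ I →
      ∀ (A B : Type u) [AddCommGroup A] [Module S A] [AddCommGroup B] [Module S B]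
        (f : A →ₗ[S] B), Function.Injective f → Function.Injective (NTensor.rmap I f))
    (M : ModuleCat.{u} S) : IsGorensteinFlat S M := by
  obtain ⟨Z, hZ, hP⟩ := exists_int_chain h.exists_hasFlatExtension_right
    (exists_hasFlatExtension_left S) M
  have hP' : ∀ n, HasFlatExtension S (Z (n - 1)) (Z (n + 1 - 1)) := fun n => by
    rw [show n + 1 - 1 = n - 1 + 1 by ring]
    exact hP _
  choose F ι π hF hι hπ hex using hP'
  have hd : ∀ n, Function.Exact (ι (n + 1) ∘ₗ π n) (π (n + 1)) := fun n => by
    rw [LinearMap.exact_iff, LinearMap.range_comp_of_range_eq_top _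
      (LinearMap.range_eq_top.2 (hπ n)), (LinearMap.exact_iff).1 (hex (n + 1))]
  refine ⟨F, fun n => ι (n + 1) ∘ₗ π n, hF, fun n => ?_, ⟨?_⟩, ?_⟩
  · exact (hd n).comp_injective _ (hι (n + 1 + 1)) (map_zero (ι (n + 1 + 1)))
  · have h₁ : LinearMap.range (ι (0 + 1) ∘ₗ π 0) = LinearMap.range (ι (0 + 1)) :=
      LinearMap.range_comp_of_range_eq_top _ (LinearMap.range_eq_top.2 (hπ 0))
    have h₂ : Z (0 + 1 - 1) = M := hZ
    rw [h₁]
    exact (CategoryTheory.eqToIso h₂.symm).toLinearEquiv.trans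
      (LinearEquiv.ofInjective _ (hι (0 + 1)))
  · intro I _ _ hI n
    change Function.Exact (NTensor.rmap I (ι (n + 1) ∘ₗ π n))
      (NTensor.rmap I (ι (n + 1 + 1) ∘ₗ π (n + 1)))
    rw [NTensor.rmap_comp (ι (n + 1 + 1))]
    exact (NTensor.rmap_exact (hd n) (hπ _)).comp_injective _ (H I hI _ _ _ (hι _)) (map_zero _)

/-- If `R` is an IF ring (every injective left `R`-module and every injective right `R`-module
is flat), then every left `R`-module and every right `R`-module is Gorenstein flat. -/
theorem isGorensteinFlat_of_IF (R : Type u) [Ring R]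
    (h1 : IsLeftIF R) (h2 : IsLeftIF Rᵐᵒᵖ) :
    (∀ M : ModuleCat.{u} R, IsGorensteinFlat R M) ∧
    (∀ N : ModuleCat.{u} Rᵐᵒᵖ, IsGorensteinFlat Rᵐᵒᵖ N) := by
  refine ⟨h1.isGorensteinFlat fun I _ _ hI A B _ _ _ _ f hf => ?_,
    h2.isGorensteinFlat fun I _ _ hI A B _ _ _ _ f hf => ?_⟩
  · exact NTensor.rmap_injective_of_isFlatMod (RingEquiv.refl _) (fun _ _ => rfl)
      (h2 (ModuleCat.of Rᵐᵒᵖ I) hI) f hf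
  · let e : R ≃+* Rᵐᵒᵖᵐᵒᵖ := RingEquiv.opOp R
    let _ : Module R I := Module.compHom I e.toRingHom
    have := RingHomInvPair.of_ringEquiv e.symm
    have := (RingHomInvPair.of_ringEquiv e.symm).symm
    have hI' : Module.Injective R I :=
      Module.Injective.of_ringEquiv (M := I) (N := I) e.symm
        { AddEquiv.refl I with
          map_smul' := fun r x => by
            change r • x = e (e.symm r) • x
            rw [RingEquiv.apply_symm_apply] }
    exact NTensor.rmap_injective_of_isFlatMod e (fun _ _ => rfl)
      (h1 (ModuleCat.of R I) hI') f hf
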